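/- Let m be a positive integer and let α > 0 be such that 2α is a positive integer. Then ∑_{k=1}^{m} ( ψ₁(k)/(2α+k) - ψ₁(2α+k)/(2α+k) - ψ₁(k)/(2α+k+m) + ψ₁(2α+k)/(2α+k+m) ) = -ψ₀(1)·ψ₁(2α+1) - ψ₁(m+1)·(ψ₀(2α+1) - 2ψ₀(2α+m+1)) - ψ₁(m+1)·ψ₀(2α+2m+1) + ψ₀(1)·ψ₁(2α+m+1) - ψ₀(m+1)·ψ₁(2α+m+1) - ψ₀(2α+m+1)·ψ₁(2α+m+1) + ψ₀(2α+2m+1)·ψ₁(2α+m+1) + ψ₁(2α+1)·ψ₀(m+1) + ψ₁(2α+1)·(ψ₀(2α+1) - ψ₀(2α+m+1)). -/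

import Mathlib

open Finset

/-- Digamma function at a positive integer argument: `ψ₀ l = -γ + ∑_{i=1}^{l-1} 1/i`. -/
noncomputable def ψ₀ (l : ℕ) : ℝ :=
  -Real.eulerMascheroniConstant + ∑ i ∈ Finset.range (l - 1), (1 : ℝ) / (i + 1)

/-- Trigamma function at a positive integer argument: `ψ₁ l = π²/6 - ∑_{i=1}^{l-1} 1/i²`. -/
noncomputable def ψ₁ (l : ℕ) : ℝ :=
  Real.pi ^ 2 / 6 - ∑ i ∈ Finset.range (l - 1), (1 : ℝ) / (i + 1) ^ 2

/-- Tetragamma function at a positive integer argument: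
`ψ₂ l = -2ζ(3) + 2∑_{i=1}^{l-1} 1/i³`, where `ζ(3) = ∑_{i=1}^∞ 1/i³`. -/
noncomputable def ψ₂ (l : ℕ) : ℝ :=
  -2 * (∑' i : ℕ, (1 : ℝ) / (i + 1) ^ 3) +
    2 * ∑ i ∈ Finset.range (l - 1), (1 : ℝ) / (i + 1) ^ 3

/-- harmonic numbers -/
noncomputable def hH (n : ℕ) : ℝ := ∑ i ∈ Finset.range n, (1 : ℝ) / (i + 1)

/-- second-order harmonic numbers -/
noncomputable def hQ (n : ℕ) : ℝ := ∑ i ∈ Finset.range n, (1 : ℝ) / (i + 1) ^ 2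

lemma hH_succ (n : ℕ) : hH (n + 1) = hH n + 1 / ((n : ℝ) + 1) := by
  simp [hH, Finset.sum_range_succ]

lemma hQ_succ (n : ℕ) : hQ (n + 1) = hQ n + 1 / ((n : ℝ) + 1) ^ 2 := by
  simp [hQ, Finset.sum_range_succ]

lemma psi0_succ (n : ℕ) : ψ₀ (n + 1) = -Real.eulerMascheroniConstant + hH n := by
  simp [ψ₀, hH]

lemma psi1_succ (n : ℕ) : ψ₁ (n + 1) = Real.pi ^ 2 / 6 - hQ n := by
  simp [ψ₁, hQ]

lemma shift_telescope (n M m : ℕ) :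
    ∑ j ∈ Finset.range m, (hQ (n + j) - hQ j) *
      (1 / ((n : ℝ) + M + j + 1) - 1 / ((n : ℝ) + M + j + 2)) =
    hQ n / ((n : ℝ) + M + 1) - (hQ (n + m) - hQ m) / ((n : ℝ) + M + m + 1)
      - hQ m / ((n : ℝ) + M + 1)
      + (hH m - (hH (n + M + 1 + m) - hH (n + M + 1))) / ((n : ℝ) + M + 1) ^ 2
      + (hQ (n + m) - hQ n) / ((M : ℝ) + 1)
      - (hH (n + m) - hH n - (hH (n + M + 1 + m) - hH (n + M + 1))) / ((M : ℝ) + 1) ^ 2 := by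
  induction m with
  | zero => simp [hQ, hH]
  | succ m ih =>
    rw [Finset.sum_range_succ, ih, ← add_assoc, ← add_assoc, hQ_succ, hQ_succ, hH_succ m,
      hH_succ (n + M + 1 + m), hH_succ (n + m)]
    push_cast
    generalize hQ (n + m) = a
    generalize hQ m = b
    generalize hH (n + M + 1 + m) = c
    generalize hH (n + m) = d
    have h1 : (n : ℝ) + M + 1 ≠ 0 := by positivity
    have h2 : (n : ℝ) + M + m + 1 ≠ 0 := by positivity
    have h3 : (n : ℝ) + M + m + 2 ≠ 0 := by positivity
    have h4 : (M : ℝ) + 1 ≠ 0 := by positivity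
    have h5 : (n : ℝ) + m + 1 ≠ 0 := by positivity
    have h6 : (m : ℝ) + 1 ≠ 0 := by positivity
    have e1 : (n : ℝ) + M + (m + 1) + 1 = n + M + m + 2 := by ring
    have e2 : (n : ℝ) + M + 1 + m + 1 = n + M + m + 2 := by ring
    rw [e1, e2]
    field_simp
    ring

lemma main_sum (n m : ℕ) :
    ∑ j ∈ Finset.range m, (hQ (n + j) - hQ j) *
      (1 / ((n : ℝ) + j + 1) - 1 / ((n : ℝ) + m + j + 1)) =
    -hQ n * (hH m + hH n - hH (n + m)) + hQ m * (hH n - 2 * hH (n + m) + hH (n + 2 * m))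
      - hQ (n + m) * (hH (n + 2 * m) - hH m - hH (n + m)) := by
  induction m with
  | zero => simp [hQ, hH]
  | succ m ih =>
    have key : ∑ j ∈ Finset.range (m + 1), (hQ (n + j) - hQ j) *
        (1 / ((n : ℝ) + j + 1) - 1 / ((n : ℝ) + (m + 1 : ℕ) + j + 1)) =
        (∑ j ∈ Finset.range m, (hQ (n + j) - hQ j) *
          (1 / ((n : ℝ) + j + 1) - 1 / ((n : ℝ) + m + j + 1))) +
        (∑ j ∈ Finset.range m, (hQ (n + j) - hQ j) *
          (1 / ((n : ℝ) + m + j + 1) - 1 / ((n : ℝ) + m + j + 2))) +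
        (hQ (n + m) - hQ m) * (1 / ((n : ℝ) + m + 1) - 1 / ((n : ℝ) + 2 * m + 2)) := by
      rw [Finset.sum_range_succ, ← Finset.sum_add_distrib]
      congr 1
      · apply Finset.sum_congr rfl
        intro j _
        have e : (n : ℝ) + (m + 1 : ℕ) + j + 1 = n + m + j + 2 := by push_cast; ring
        rw [e]; ring
      · have e : (n : ℝ) + (m + 1 : ℕ) + m + 1 = n + 2 * m + 2 := by push_cast; ring
        rw [e]
    rw [key, ih, shift_telescope]
    have i1 : n + m + 1 + m = n + 2 * m + 1 := by ring
    have i2 : n + 2 * (m + 1) = n + 2 * m + 1 + 1 := by ring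
    rw [i1, i2, ← add_assoc, hH_succ (n + 2 * m + 1), hH_succ (n + 2 * m), hH_succ (n + m),
      hH_succ m, hQ_succ (n + m), hQ_succ m]
    push_cast
    generalize hQ (n + m) = a
    generalize hQ m = b
    generalize hH (n + 2 * m) = c
    generalize hH (n + m) = d
    generalize hH m = e
    generalize hH n = f
    generalize hQ n = g
    have e1 : (n : ℝ) + m + m + 1 = n + 2 * m + 1 := by ring
    have e2 : (n : ℝ) + 2 * m + 1 + 1 = n + 2 * m + 2 := by ring
    rw [e1, e2]
    have h1 : (n : ℝ) + m + 1 ≠ 0 := by positivity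
    have h2 : (n : ℝ) + 2 * m + 1 ≠ 0 := by positivity
    have h3 : (n : ℝ) + 2 * m + 2 ≠ 0 := by positivity
    have h4 : (m : ℝ) + 1 ≠ 0 := by positivity
    field_simp
    ring

theorem stmt19 (m n : ℕ) (α : ℝ) (hm : 0 < m) (hα : 0 < α) (hn : 0 < n)
    (hnα : (n : ℝ) = 2 * α) :
    ∑ k ∈ Finset.Icc 1 m, (ψ₁ k / (2 * α + k) - ψ₁ (n + k) / (2 * α + k) -
        ψ₁ k / (2 * α + k + m) + ψ₁ (n + k) / (2 * α + k + m)) =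
      -ψ₀ 1 * ψ₁ (n + 1) - ψ₁ (m + 1) * (ψ₀ (n + 1) - 2 * ψ₀ (n + m + 1)) -
      ψ₁ (m + 1) * ψ₀ (n + 2 * m + 1) + ψ₀ 1 * ψ₁ (n + m + 1) -
      ψ₀ (m + 1) * ψ₁ (n + m + 1) - ψ₀ (n + m + 1) * ψ₁ (n + m + 1) +
      ψ₀ (n + 2 * m + 1) * ψ₁ (n + m + 1) + ψ₁ (n + 1) * ψ₀ (m + 1) +
      ψ₁ (n + 1) * (ψ₀ (n + 1) - ψ₀ (n + m + 1)) := by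
  have h := main_sum n m
  have h2 : ∑ k ∈ Finset.Icc 1 m, (ψ₁ k / (2 * α + k) - ψ₁ (n + k) / (2 * α + k) -
        ψ₁ k / (2 * α + k + m) + ψ₁ (n + k) / (2 * α + k + m)) =
      ∑ j ∈ Finset.range m, (hQ (n + j) - hQ j) *
      (1 / ((n : ℝ) + j + 1) - 1 / ((n : ℝ) + m + j + 1)) := by
    rw [← Finset.Ico_add_one_right_eq_Icc, Finset.sum_Ico_eq_sum_range]
    apply Finset.sum_congr rfl
    intro j _
    rw [← hnα, add_comm 1 j, ← add_assoc, psi1_succ, psi1_succ]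
    have e1 : (n : ℝ) + (j + 1 : ℕ) = n + j + 1 := by push_cast; ring
    have e2 : (n : ℝ) + j + 1 + m = n + m + j + 1 := by ring
    rw [e1, e2]
    ring
  have z0 : ψ₀ 1 = -Real.eulerMascheroniConstant := by simp [ψ₀]
  rw [h2, h, z0]
  simp only [psi0_succ, psi1_succ]
  ring
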